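/- Let m₁, m₂ be positive integers and ε̌ > 0. For each ε ∈ (0, ε̌] let C(ε) be the (m₁+m₂)×(m₁+m₂) matrix with block form C(ε) = (C₁(ε), C₂(ε); (1/ε)C₃(ε), (1/ε)C₄(ε)), with C₁(ε) of size m₁×m₁ and C₄(ε) of size m₂×m₂, and let Ψ(t,ε) solve dΨ/dt = C(ε)Ψ(t,ε), Ψ(0,ε) = I_{m₁+m₂}, with block partition Ψ = (Ψ₁, Ψ₂; Ψ₃, Ψ₄) conformal with (m₁, m₂). Assume: the matrices C_j(ε), j = 1,…,4, are continuous in ε on [0, ε̌]; there exists ω > 0 such that Re λ < −ω for every eigenvalue λ of C₄(ε) and every ε ∈ [0, ε̌]; and there exists κ > 0 such that Re λ < −κ for every eigenvalue λ of C̄(ε) = C₁(ε) − C₂(ε)C₄^{-1}(ε)C₃(ε) and every ε ∈ [0, ε̌]. Then there exists ε̄ ∈ (0, ε̌] and a constant a > 0 independent of ε such that for all ε ∈ (0, ε̄] and all t ≥ 0: ‖Ψ₁(t,ε)‖ ≤ a e^{−κt}, ‖Ψ₃(t,ε)‖ ≤ a e^{−κt}, ‖Ψ₂(t,ε)‖ ≤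 aε e^{−κt}, and ‖Ψ₄(t,ε)‖ ≤ a(ε e^{−κt} + e^{−ωt/ε}). -/

import Mathlib

open Matrix MeasureTheory Filter Set
open scoped Topology

attribute [local instance] Matrix.normedAddCommGroup Matrix.normedSpace

noncomputable section

/-- A real square matrix is Hurwitz if all of its complex eigenvalues have negative real part. -/
def Matrix.IsHurwitz {m : Type*} [Fintype m] [DecidableEq m] (M : Matrix m m ℝ) : Prop :=
  ∀ ν ∈ spectrum ℂ (M.map (Complex.ofReal ·)), ν.re < 0

/-- PBH-test stabilizability of the pair (A, B). -/
def Matrix.IsStabilizablePair {m k : Type*} [Fintype m] [Fintype k] [DecidableEq m]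
    (A : Matrix m m ℝ) (B : Matrix m k ℝ) : Prop :=
  ∀ ν : ℂ, 0 ≤ ν.re → ∀ v : m → ℂ,
    v ᵥ* (A.map (Complex.ofReal ·) - ν • 1) = 0 → v ᵥ* (B.map (Complex.ofReal ·)) = 0 → v = 0

/-- Detectability of the pair (A, F), as stabilizability of the dual pair. -/
def Matrix.IsDetectablePair {m k : Type*} [Fintype m] [Fintype k] [DecidableEq m] [DecidableEq k]
    (A : Matrix m m ℝ) (F : Matrix k m ℝ) : Prop :=
  Matrix.IsStabilizablePair Aᵀ Fᵀ

/-- `z` is a (locally absolutely continuous) solution on `[0,∞)` of the closed-loop system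
`dz/dt = A z + B u(z,t) + f(t)`, `z 0 = z₀`, in Carathéodory (integral-equation) form. -/
def IsClosedLoopSol {ι κ : Type*} [Fintype ι] [Fintype κ]
    (A : Matrix ι ι ℝ) (B : Matrix ι κ ℝ) (f : ℝ → ι → ℝ) (z₀ : ι → ℝ)
    (u : (ι → ℝ) → ℝ → κ → ℝ) (z : ℝ → ι → ℝ) : Prop :=
  ContinuousOn z (Set.Ici 0) ∧ z 0 = z₀ ∧
    ∀ t ∈ Set.Ici (0:ℝ), z t = z₀ + ∫ s in (0:ℝ)..t, (A *ᵥ z s + B *ᵥ u (z s) s + f s)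

/-- Admissible state-feedback control: measurable in time, locally Lipschitz in the state
uniformly in time, the closed-loop problem has a unique solution on `[0,∞)`, and both the
state and the control realization are square integrable on `[0,∞)`. -/
def IsAdmissible {ι κ : Type*} [Fintype ι] [Fintype κ]
    (A : Matrix ι ι ℝ) (B : Matrix ι κ ℝ) (f : ℝ → ι → ℝ) (z₀ : ι → ℝ)
    (u : (ι → ℝ) → ℝ → κ → ℝ) : Prop :=
  (∀ w : ι → ℝ, Measurable fun t : ℝ => u w t) ∧
  (∀ R : ℝ, ∃ L : ℝ, ∀ t ∈ Set.Ici (0:ℝ), ∀ w₁ w₂ : ι → ℝ, ‖w₁‖ ≤ R → ‖w₂‖ ≤ R →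
      ‖u w₁ t - u w₂ t‖ ≤ L * ‖w₁ - w₂‖) ∧
  (∃! z, IsClosedLoopSol A B f z₀ u z) ∧
  (∀ z, IsClosedLoopSol A B f z₀ u z →
      IntegrableOn (fun t => ‖z t‖ ^ 2) (Set.Ici 0) ∧
      IntegrableOn (fun t => ‖u (z t) t‖ ^ 2) (Set.Ici 0))

/-- The quadratic cost of a feedback control along a trajectory. -/
def cost {ι κ : Type*} [Fintype ι] [Fintype κ]
    (D : Matrix ι ι ℝ) (G : Matrix κ κ ℝ)
    (u : (ι → ℝ) → ℝ → κ → ℝ) (z : ℝ → ι → ℝ) : ℝ :=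
  ∫ t in Set.Ici (0:ℝ), (z t ⬝ᵥ D *ᵥ z t + u (z t) t ⬝ᵥ G *ᵥ u (z t) t)

/-- The set of values of the cost functional over admissible state-feedback controls. -/
def costValues {ι κ : Type*} [Fintype ι] [Fintype κ]
    (A : Matrix ι ι ℝ) (B : Matrix ι κ ℝ) (D : Matrix ι ι ℝ) (G : Matrix κ κ ℝ)
    (f : ℝ → ι → ℝ) (z₀ : ι → ℝ) : Set ℝ :=
  {c | ∃ u z, IsAdmissible A B f z₀ u ∧ IsClosedLoopSol A B f z₀ u z ∧ c = cost D G u z}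

end

section LinearFlow
open NormedSpace

variable {E : Type*}

theorem hasDerivAt_exp_ofReal_smul [NormedAddCommGroup E] [NormedSpace ℂ E] [CompleteSpace E]
    (A : E →L[ℂ] E) (t : ℝ) :
    HasDerivAt (fun s : ℝ => exp ((s : ℂ) • A)) (A * exp ((t : ℂ) • A)) t := by
  have h := (hasDerivAt_exp_smul_const' (𝕂 := ℂ) A (t : ℂ)).scomp t
    (Complex.ofRealCLM.hasDerivAt (x := t))
  simp only [Complex.ofRealCLM_apply, Complex.ofReal_one, one_smul] at h
  exact h

theorem exp_smul_apply_of_pow_apply_eq_zero [NormedAddCommGroup E] [NormedSpace ℂ E]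
    [CompleteSpace E] (A : E →L[ℂ] E) (μ : ℂ) (k : ℕ) (v : E)
    (hv : ((A - μ • 1) ^ k) v = 0) (z : ℂ) :
    exp (z • A) v = Complex.exp (z * μ) •
      ∑ n ∈ Finset.range k, ((n.factorial : ℂ)⁻¹ * z ^ n) • ((A - μ • 1) ^ n) v := by
  set N := A - μ • (1 : E →L[ℂ] E) with hN
  have hA : z • A = (z * μ) • (1 : E →L[ℂ] E) + z • N := by
    rw [hN, smul_sub, smul_smul]; abel
  let _ : NormedAlgebra ℚ (E →L[ℂ] E) := NormedAlgebra.restrictScalars ℚ ℂ _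
  have hc : Commute ((z * μ) • (1 : E →L[ℂ] E)) (z • N) :=
    ((Commute.one_left _).smul_left _)
  have h1 : exp ((z * μ) • (1 : E →L[ℂ] E)) = Complex.exp (z * μ) • (1 : E →L[ℂ] E) := by
    have := algebraMap_exp_comm (𝕂 := ℂ) (𝔸 := E →L[ℂ] E) (z * μ)
    rw [Algebra.algebraMap_eq_smul_one, Algebra.algebraMap_eq_smul_one] at this
    rw [← this, Complex.exp_eq_exp_ℂ]
  have h2 : HasSum (fun n : ℕ => ((n.factorial : ℂ)⁻¹ • (z • N) ^ n) v) (exp (z • N) v) :=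
    (exp_series_hasSum_exp' (𝕂 := ℂ) (z • N)).mapL (ContinuousLinearMap.apply ℂ E v)
  have h3 : HasSum (fun n : ℕ => ((n.factorial : ℂ)⁻¹ • (z • N) ^ n) v)
      (∑ n ∈ Finset.range k, ((n.factorial : ℂ)⁻¹ • (z • N) ^ n) v) := by
    refine hasSum_sum_of_ne_finset_zero fun n hn => ?_
    have hk : k ≤ n := by simpa using hn
    obtain ⟨j, rfl⟩ := Nat.exists_eq_add_of_le' hk
    simp [smul_pow, pow_add, hv]
  rw [hA, exp_add_of_commute hc, h1]
  simp only [smul_mul_assoc, one_mul, _root_.smul_apply]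
  rw [h2.unique h3]
  simp [smul_pow, smul_smul]

theorem tendsto_cexp_mul_pow_atTop {μ : ℂ} (hμ : μ.re < 0) (n : ℕ) :
    Tendsto (fun t : ℝ => Complex.exp (t * μ) * (t : ℂ) ^ n) atTop (𝓝 0) := by
  rw [tendsto_zero_iff_norm_tendsto_zero]
  have h := (isLittleO_pow_exp_pos_mul_atTop (k := n) (neg_pos.2 hμ)).tendsto_div_nhds_zero
  have h' := h.norm
  rw [norm_zero] at h'
  refine h'.congr fun t => ?_
  rw [norm_div, norm_mul, Complex.norm_exp, norm_pow, norm_pow, Complex.norm_real,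
    Real.norm_of_nonneg (Real.exp_pos _).le, div_eq_mul_inv, ← Real.exp_neg, mul_comm]
  congr 2
  simp
  ring

theorem tendsto_exp_smul_apply_zero [NormedAddCommGroup E] [NormedSpace ℂ E] [FiniteDimensional ℂ E]
    (A : E →L[ℂ] E) (hA : ∀ μ : ℂ, Module.End.HasEigenvalue (A : E →ₗ[ℂ] E) μ → μ.re < 0) (v : E) :
    Tendsto (fun t : ℝ => exp ((t : ℂ) • A) v) atTop (𝓝 0) := by
  have := FiniteDimensional.complete ℂ E
  have hv : v ∈ ⨆ μ, Module.End.maxGenEigenspace (A : E →ₗ[ℂ] E) μ := by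
    rw [Module.End.iSup_maxGenEigenspace_eq_top]; trivial
  refine Submodule.iSup_induction _ (motive := fun v => Tendsto (fun t : ℝ => exp ((t : ℂ) • A) v)
    atTop (𝓝 0)) hv (fun μ x hx => ?_) (by simp) (fun x y hx hy => by simpa using hx.add hy)
  rcases eq_or_ne x 0 with rfl | hx0
  · simp
  have hμ : μ.re < 0 := by
    have h : Module.End.HasUnifEigenvalue (A : E →ₗ[ℂ] E) μ ⊤ :=
      fun hbot => hx0 (by rwa [Module.End.maxGenEigenspace, hbot, Submodule.mem_bot] at hx)
    exact hA μ (h.lt zero_lt_one)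
  rw [Module.End.mem_maxGenEigenspace] at hx
  obtain ⟨k, hk⟩ := hx
  have hk' : ((A - μ • 1) ^ k) x = 0 := by
    rw [← hk, ← ContinuousLinearMap.coe_coe, ContinuousLinearMap.toLinearMap_pow]
    rfl
  simp_rw [exp_smul_apply_of_pow_apply_eq_zero A μ k x hk', Finset.smul_sum, smul_smul]
  rw [← Finset.sum_const_zero (s := Finset.range k) (ι := ℕ)]
  refine tendsto_finsetSum _ fun n _ => ?_
  have := ((tendsto_cexp_mul_pow_atTop hμ n).const_mul ((n.factorial : ℂ)⁻¹)).smul_const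
    (((A - μ • 1) ^ n) x)
  rw [mul_zero, zero_smul] at this
  refine this.congr fun t => ?_
  congr 1
  ring

theorem exists_pos_norm_exp_smul_apply_le [NormedAddCommGroup E] [InnerProductSpace ℂ E]
    [FiniteDimensional ℂ E] (A : E →L[ℂ] E)
    (hA : ∀ μ : ℂ, Module.End.HasEigenvalue (A : E →ₗ[ℂ] E) μ → μ.re < 0) {c : ℝ} (hc : 0 < c) :
    ∃ T : ℝ, 0 < T ∧ ∀ v, ‖exp ((T : ℂ) • A) v‖ ≤ c * ‖v‖ := by
  let b := stdOrthonormalBasis ℂ E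
  have h : Tendsto (fun t : ℝ => ∑ i, ‖exp ((t : ℂ) • A) (b i)‖) atTop (𝓝 0) := by
    rw [← Finset.sum_const_zero (s := Finset.univ) (ι := Fin (Module.finrank ℂ E))]
    exact tendsto_finsetSum _ fun i _ => by
      simpa using (tendsto_exp_smul_apply_zero A hA (b i)).norm
  obtain ⟨T, hT, hT0⟩ := ((h.eventually_lt_const hc).and (eventually_gt_atTop 0)).exists
  refine ⟨T, hT0, fun v => ?_⟩
  calc ‖exp ((T : ℂ) • A) v‖ = ‖∑ i, inner ℂ (b i) v • exp ((T : ℂ) • A) (b i)‖ := by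
        conv_lhs => rw [← b.sum_repr' v, map_sum]
        simp only [map_smul]
    _ ≤ ∑ i, ‖v‖ * ‖exp ((T : ℂ) • A) (b i)‖ := by
        refine norm_sum_le_of_le _ fun i _ => ?_
        rw [norm_smul]
        gcongr
        simpa using norm_inner_le_norm (𝕜 := ℂ) (b i) v
    _ ≤ c * ‖v‖ := by
        rw [← Finset.mul_sum, mul_comm]
        gcongr

/-- The Lyapunov theorem with decay rate `ω`: if the eigenvalues of `A` have real part less than `-ω`,
some positive definite form `P` decreases along the flow of `A` at a rate better than `2 * ω`. -/
theorem exists_lyapunov [NormedAddCommGroup E] [InnerProductSpace ℂ E]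
    [FiniteDimensional ℂ E] (A : E →L[ℂ] E) (ω : ℝ)
    (hA : ∀ μ : ℂ, Module.End.HasEigenvalue (A : E →ₗ[ℂ] E) μ → μ.re < -ω) :
    ∃ P : E →L[ℂ] E, (∀ v w, (inner ℂ (P v) w).re = (inner ℂ (P w) v).re) ∧
      (∃ p : ℝ, 0 < p ∧ ∀ v, p * ‖v‖ ^ 2 ≤ (inner ℂ (P v) v).re) ∧
      ∃ s : ℝ, 0 < s ∧ ∀ v, (inner ℂ (P v) (A v)).re ≤ -ω * (inner ℂ (P v) v).re - s * ‖v‖ ^ 2 := by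
  have := FiniteDimensional.complete ℂ E
  set B : E →L[ℂ] E := A + (ω : ℂ) • 1 with hB
  have hBspec : ∀ μ : ℂ, Module.End.HasEigenvalue (B : E →ₗ[ℂ] E) μ → μ.re < 0 := by
    intro μ hμ
    obtain ⟨x, hx⟩ := hμ.exists_hasEigenvector
    have h1 : Module.End.HasEigenvalue (A : E →ₗ[ℂ] E) (μ - ω) := by
      refine Module.End.hasEigenvalue_of_hasEigenvector (x := x) ⟨?_, hx.2⟩
      rw [Module.End.mem_genEigenspace_one]
      have := hx.apply_eq_smul
      simp only [hB, ContinuousLinearMap.coe_coe, _root_.add_apply, _root_.smul_apply,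
        one_apply_eq_self] at this ⊢
      rw [sub_smul, ← this]; abel
    have := hA _ h1
    simp at this
    linarith
  obtain ⟨T, hT, hTle⟩ := exists_pos_norm_exp_smul_apply_le B hBspec (c := 1 / 2) (by norm_num)
  set Φ : ℝ → E →L[ℂ] E := fun t => exp ((t : ℂ) • B) with hΦ
  have hΦd : ∀ t, HasDerivAt Φ (B * Φ t) t := hasDerivAt_exp_ofReal_smul B
  have hΦc : Continuous Φ := continuous_iff_continuousAt.2 fun t => (hΦd t).continuousAt
  have hcomm : ∀ t, Φ t * B = B * Φ t := fun t =>
    (((Commute.refl B).smul_left (t : ℂ)).exp_left).eq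
  have hΦ0 : Φ 0 = 1 := by simp [hΦ]
  set F : ℝ → E →L[ℂ] E := fun t => ContinuousLinearMap.adjoint (Φ t) ∘L Φ t with hF
  have hFc : Continuous F := by
    have : Continuous fun t => ContinuousLinearMap.adjoint (Φ t) :=
      ContinuousLinearMap.adjoint.continuous.comp hΦc
    exact this.clm_comp hΦc
  have hPi : ∀ v w, (inner ℂ ((∫ t in (0:ℝ)..T, F t) v) w).re =
      ∫ t in (0:ℝ)..T, (inner ℂ (Φ t v) (Φ t w)).re := by
    intro v w
    have hi : IntervalIntegrable (fun t => F t v) volume 0 T :=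
      (hFc.clm_apply continuous_const).intervalIntegrable _ _
    have h1 := (Complex.reCLM ∘L (innerSL ℂ w).restrictScalars ℝ).intervalIntegral_comp_comm hi
    rw [ContinuousLinearMap.intervalIntegral_apply (hFc.intervalIntegrable _ _)]
    rw [← inner_conj_symm, Complex.conj_re]
    refine Eq.trans h1.symm (intervalIntegral.integral_congr fun t _ => ?_)
    simp only [ContinuousLinearMap.comp_apply, hF, ContinuousLinearMap.coe_restrictScalars',
      innerSL_apply_apply, Complex.reCLM_apply, ContinuousLinearMap.adjoint_inner_right]
    rw [← inner_conj_symm, Complex.conj_re]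
  have hre : ∀ v w : E, (inner ℂ v w).re = (inner ℂ w v).re := fun v w => by
    rw [← inner_conj_symm, Complex.conj_re]
  have hself : ∀ v : E, (inner ℂ v v).re = ‖v‖ ^ 2 := fun v => by
    rw [inner_self_eq_norm_sq_to_K]; norm_cast
  refine ⟨∫ t in (0:ℝ)..T, F t, fun v w => ?_, ?_, 3 / 8, by norm_num, fun v => ?_⟩
  · simp_rw [hPi, hre (Φ _ v)]
  · obtain ⟨M, hM⟩ := (isCompact_Icc (a := (0:ℝ)) (b := T)).exists_bound_of_continuousOn
      (f := fun t => Φ (-t)) (hΦc.comp continuous_neg).continuousOn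
    have hM' : 0 < 1 + |M| := by positivity
    refine ⟨T / (1 + |M|) ^ 2, by positivity, fun v => ?_⟩
    rw [hPi]
    have hle : ∀ t ∈ Icc 0 T, ‖v‖ ^ 2 / (1 + |M|) ^ 2 ≤ (inner ℂ (Φ t v) (Φ t v)).re := by
      intro t ht
      rw [hself, ← div_pow]
      gcongr
      rw [div_le_iff₀ hM', mul_comm]
      have hinv : Φ (-t) (Φ t v) = v := by
        let _ : NormedAlgebra ℚ (E →L[ℂ] E) := NormedAlgebra.restrictScalars ℚ ℂ _
        have : Φ (-t) * Φ t = 1 := by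
          simp only [hΦ]
          rw [← NormedSpace.exp_add_of_commute (((Commute.refl B).smul_left _).smul_right _),
            ← add_smul]
          simp
        rw [← mul_apply_eq_comp, this, one_apply_eq_self]
      calc ‖v‖ = ‖Φ (-t) (Φ t v)‖ := by rw [hinv]
        _ ≤ ‖Φ (-t)‖ * ‖Φ t v‖ := (Φ (-t)).le_opNorm _
        _ ≤ (1 + |M|) * ‖Φ t v‖ := by
          gcongr
          linarith [hM t ht, le_abs_self M]
    have hcont : Continuous fun t => (inner ℂ (Φ t v) (Φ t v)).re :=
      Complex.continuous_re.comp ((hΦc.clm_apply continuous_const).inner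
        (hΦc.clm_apply continuous_const))
    have := intervalIntegral.integral_mono_on (μ := volume) hT.le intervalIntegrable_const
      (hcont.intervalIntegrable _ _) hle
    rw [intervalIntegral.integral_const, smul_eq_mul, sub_zero] at this
    refine le_trans (le_of_eq ?_) this
    ring
  · have hd : ∀ t, HasDerivAt (fun t => (‖Φ t v‖ ^ 2) / 2) (inner ℂ (Φ t v) (Φ t (B v))).re t := by
      intro t
      have h1 : HasDerivAt (fun t => Φ t v) (Φ t (B v)) t := by
        have := (((ContinuousLinearMap.apply ℂ E v).restrictScalars ℝ).hasFDerivAt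
          (x := Φ t)).comp_hasDerivAt t (hΦd t)
        rw [← mul_apply_eq_comp, hcomm]
        exact this
      have h2 := Complex.reCLM.hasFDerivAt.comp_hasDerivAt t (h1.inner ℂ h1)
      have h3 := h2.div_const 2
      refine (h3.congr_of_eventuallyEq (Eventually.of_forall fun t => ?_)).congr_deriv ?_
      · simp only [Function.comp_apply, Complex.reCLM_apply, hself]
      · simp [hre (Φ t (B v))]
    have hcont : Continuous fun t => (inner ℂ (Φ t v) (Φ t (B v))).re :=
      Complex.continuous_re.comp ((hΦc.clm_apply continuous_const).inner
        (hΦc.clm_apply continuous_const))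
    have hFTC := intervalIntegral.integral_eq_sub_of_hasDerivAt (fun t _ => hd t)
      (hcont.intervalIntegrable 0 T)
    rw [← hPi, hΦ0, one_apply_eq_self] at hFTC
    have hAv : A v = B v - (ω : ℂ) • v := by simp [hB]
    have hT2 : ‖Φ T v‖ ^ 2 ≤ (1 / 2 * ‖v‖) ^ 2 := by
      have := hTle v
      gcongr
    rw [hAv, inner_sub_right, inner_smul_right, Complex.sub_re, hFTC, Complex.re_ofReal_mul]
    linarith

end LinearFlow

theorem le_mul_exp_of_hasDerivAt_le {U U' : ℝ → ℝ} {k : ℝ}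
    (hU : ∀ t, HasDerivAt U (U' t) t) (h : ∀ t, 0 ≤ t → U' t ≤ -k * U t) {t : ℝ} (ht : 0 ≤ t) :
    U t ≤ U 0 * Real.exp (-k * t) := by
  have hd : ∀ t, HasDerivAt (fun t => U t * Real.exp (k * t))
      (U' t * Real.exp (k * t) + U t * (Real.exp (k * t) * k)) t := fun t => by
    have := ((hasDerivAt_id t).const_mul k).exp
    simp only [id, mul_one] at this
    exact (hU t).mul this
  have hanti : AntitoneOn (fun t => U t * Real.exp (k * t)) (Ici 0) := by
    refine antitoneOn_of_deriv_nonpos (convex_Ici 0)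
      (fun t _ => (hd t).continuousAt.continuousWithinAt)
      (fun t _ => (hd t).differentiableAt.differentiableWithinAt) fun t ht => ?_
    rw [interior_Ici] at ht
    rw [(hd t).deriv]
    have := mul_le_mul_of_nonneg_right (h t (le_of_lt ht)) (Real.exp_pos (k * t)).le
    linarith
  have := hanti self_mem_Ici ht ht
  simp only [mul_zero, Real.exp_zero, mul_one] at this
  calc U t = U t * Real.exp (k * t) * Real.exp (-k * t) := by
        rw [mul_assoc, ← Real.exp_add]; simp
    _ ≤ U 0 * Real.exp (-k * t) := by gcongr

/-- Exponential decay for a slow-fast pair of energies `V₁`, `V₂` that control the squares of the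
sizes `X`, `Y` of the slow and fast components. -/
theorem slow_fast_energy_decay {p s N κ ω c d ε : ℝ} (hp : 0 < p) (hs : 0 < s) (hN : 0 < N)
    (hκ : 0 < κ) (hω : 0 < ω) (hc : 0 ≤ c) (hd : N * d ≤ s / 2) (hε : 0 < ε) (hε1 : ε ≤ 1)
    (hεω : 2 * κ * ε ≤ ω) (hεs : 4 * (N * c) ^ 2 * ε ≤ s ^ 2)
    {X Y V₁ V₂ V₁' V₂' : ℝ → ℝ} (hX : ∀ t, 0 ≤ X t) (hY : ∀ t, 0 ≤ Y t)
    (hV₁ : ∀ t, HasDerivAt V₁ (V₁' t) t) (hV₂ : ∀ t, HasDerivAt V₂ (V₂' t) t)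
    (hpV₁ : ∀ t, p * X t ^ 2 ≤ V₁ t) (hpV₂ : ∀ t, p * Y t ^ 2 ≤ V₂ t)
    (hNV₁ : V₁ 0 ≤ N * X 0 ^ 2) (hNV₂ : V₂ 0 ≤ N * Y 0 ^ 2)
    (h₁ : ∀ t, V₁' t ≤ -2 * κ * V₁ t - 2 * s * X t ^ 2 + 2 * N * X t * (d * X t + c * ε * Y t))
    (h₂ : ∀ t, V₂' t ≤ -2 * (ω / ε) * V₂ t - 2 * (s / ε) * Y t ^ 2
      + 2 * N * Y t * (d / ε * Y t + c * X t))
    {a : ℝ} (ha : 0 ≤ a) (ha₁ : N / p ≤ a ^ 2)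
    (ha₂ : (N * c) ^ 2 * N / (s * p ^ 2 * ω) ≤ a ^ 2) {t : ℝ} (ht : 0 ≤ t) :
    X t ≤ a * (X 0 + ε * Y 0) * Real.exp (-κ * t) ∧
      Y t ≤ a * (ε * (X 0 + ε * Y 0) * Real.exp (-κ * t) + Y 0 * Real.exp (-ω * t / ε)) := by
  set S := X 0 + ε * Y 0 with hS
  have hX0 := hX 0
  have hY0 := hY 0
  have hS0 : 0 ≤ S := by positivity
  set W₀ := V₁ 0 + ε ^ 2 * V₂ 0 with hW₀
  have hW₀le : W₀ ≤ N * S ^ 2 := by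
    have h1 : ε ^ 2 * V₂ 0 ≤ ε ^ 2 * (N * Y 0 ^ 2) := by gcongr
    have h2 : 0 ≤ N * (X 0 * (ε * Y 0)) := by positivity
    rw [hW₀, hS]
    nlinarith
  have hV₁0 : ∀ t, 0 ≤ V₁ t := fun t => le_trans (by positivity) (hpV₁ t)
  have hV₂0 : ∀ t, 0 ≤ V₂ t := fun t => le_trans (by positivity) (hpV₂ t)
  have hW₀0 : 0 ≤ W₀ := add_nonneg (hV₁0 0) (mul_nonneg (by positivity) (hV₂0 0))
  have hW : ∀ t, 0 ≤ t → V₁ t + ε ^ 2 * V₂ t ≤ W₀ * Real.exp (-(2 * κ) * t) := by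
    intro t ht
    refine le_mul_exp_of_hasDerivAt_le (U := fun t => V₁ t + ε ^ 2 * V₂ t)
      (fun t => (hV₁ t).add ((hV₂ t).const_mul (ε ^ 2))) (fun t _ => ?_) ht
    have e1 := h₁ t
    have e2 := mul_le_mul_of_nonneg_left (h₂ t) (sq_nonneg ε)
    have e3 : ε ^ 2 * (-2 * (ω / ε) * V₂ t - 2 * (s / ε) * Y t ^ 2
        + 2 * N * Y t * (d / ε * Y t + c * X t)) = -2 * (ω * ε) * V₂ t - 2 * s * ε * Y t ^ 2
        + 2 * (N * d) * ε * Y t ^ 2 + 2 * N * c * ε ^ 2 * (X t * Y t) := by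
      field_simp
      ring
    rw [e3] at e2
    have e4 : N * d * X t ^ 2 ≤ s / 2 * X t ^ 2 := by gcongr
    have e5 : N * d * (ε * Y t ^ 2) ≤ s / 2 * (ε * Y t ^ 2) := by gcongr
    have hXY : 0 ≤ X t * Y t := mul_nonneg (hX t) (hY t)
    have e6 : N * c * ε ^ 2 * (X t * Y t) ≤ N * c * ε * (X t * Y t) := by
      have : ε ^ 2 ≤ ε := by nlinarith
      gcongr
    have e7 : κ * ε * (ε * V₂ t) ≤ ω * (ε * V₂ t) := by
      have := hV₂0 t
      gcongr
      have := mul_pos hκ hε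
      linarith
    have e8 : 4 * (N * c) * ε * (X t * Y t) ≤ s * X t ^ 2 + s * ε * Y t ^ 2 := by
      have h1 : 0 ≤ (s * X t - 2 * (N * c) * ε * Y t) ^ 2 := sq_nonneg _
      have h2 : 4 * (N * c) ^ 2 * ε * (ε * Y t ^ 2) ≤ s ^ 2 * (ε * Y t ^ 2) := by gcongr
      have h3 : s * (s * X t ^ 2 + s * ε * Y t ^ 2) - s * (4 * (N * c) * ε * (X t * Y t))
          = (s * X t - 2 * (N * c) * ε * Y t) ^ 2
            + (s ^ 2 * (ε * Y t ^ 2) - 4 * (N * c) ^ 2 * ε * (ε * Y t ^ 2)) := by ring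
      refine le_of_mul_le_mul_left ?_ hs
      linarith
    linarith
  set D := (N * c) ^ 2 / (s * p) with hD
  have hD0 : 0 ≤ D := by positivity
  have hXW : ∀ t, 0 ≤ t → p * X t ^ 2 ≤ W₀ * Real.exp (-(2 * κ) * t) := fun t ht => by
    have := hW t ht
    have h1 := hpV₁ t
    have h2 : 0 ≤ ε ^ 2 * V₂ t := mul_nonneg (by positivity) (hV₂0 t)
    linarith
  have hV₂le : V₂ t ≤ D / ω * ε ^ 2 * W₀ * Real.exp (-(2 * κ) * t)
      + V₂ 0 * Real.exp (-(2 * (ω / ε)) * t) := by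
    have hexp : ∀ t, HasDerivAt (fun t => D / ω * ε ^ 2 * W₀ * Real.exp (-(2 * κ) * t))
        (D / ω * ε ^ 2 * W₀ * (Real.exp (-(2 * κ) * t) * (-(2 * κ)))) t := fun t => by
      have := ((hasDerivAt_id t).const_mul (-(2 * κ))).exp
      simp only [id, mul_one] at this
      exact this.const_mul _
    have := le_mul_exp_of_hasDerivAt_le (k := 2 * (ω / ε)) (fun t => (hV₂ t).sub (hexp t))
      (fun t ht => ?_) ht
    · have h1 : V₂ 0 - D / ω * ε ^ 2 * W₀ * Real.exp (-(2 * κ) * 0) ≤ V₂ 0 := by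
        have : 0 ≤ D / ω * ε ^ 2 * W₀ * Real.exp (-(2 * κ) * 0) := by positivity
        linarith
      have h2 := mul_le_mul_of_nonneg_right h1 (Real.exp_pos (-(2 * (ω / ε)) * t)).le
      simp only [Pi.sub_apply] at this
      linarith
    · simp only [Pi.sub_apply]
      have hE := Real.exp_pos (-(2 * κ) * t)
      set e := Real.exp (-(2 * κ) * t)
      have g1 := h₂ t
      have g2 : 2 * N * c * (X t * Y t) ≤ s / ε * Y t ^ 2 + ε * ((N * c) ^ 2 / s) * X t ^ 2 := by
        have : s / ε * Y t ^ 2 + ε * ((N * c) ^ 2 / s) * X t ^ 2 - 2 * N * c * (X t * Y t)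
          = (s * Y t - N * c * ε * X t) ^ 2 / (s * ε) := by field_simp; ring
        have : 0 ≤ (s * Y t - N * c * ε * X t) ^ 2 / (s * ε) := by positivity
        linarith
      have g3 : 2 * (N * d) * (Y t ^ 2 / ε) ≤ s / ε * Y t ^ 2 := by
        calc 2 * (N * d) * (Y t ^ 2 / ε) ≤ 2 * (s / 2) * (Y t ^ 2 / ε) := by gcongr
          _ = s / ε * Y t ^ 2 := by ring
      have g4 : ε * ((N * c) ^ 2 / s) * X t ^ 2 ≤ ε * D * (W₀ * e) := by
        calc ε * ((N * c) ^ 2 / s) * X t ^ 2 = ε * D * (p * X t ^ 2) := by rw [hD]; field_simp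
          _ ≤ ε * D * (W₀ * e) := mul_le_mul_of_nonneg_left (hXW t ht) (by positivity)
      have g5 : 2 * (ω / ε) * (D / ω * ε ^ 2 * W₀ * e) = 2 * (ε * D * (W₀ * e)) := by
        field_simp
      have g6 : D / ω * ε ^ 2 * W₀ * (e * (2 * κ)) ≤ ε * D * (W₀ * e) := by
        calc D / ω * ε ^ 2 * W₀ * (e * (2 * κ)) = (2 * κ * ε) * (D / ω * ε * W₀ * e) := by ring
          _ ≤ ω * (D / ω * ε * W₀ * e) := by gcongr
          _ = ε * D * (W₀ * e) := by field_simp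
      have g7 : 2 * N * Y t * (d / ε * Y t + c * X t)
        = 2 * (N * d) * (Y t ^ 2 / ε) + 2 * N * c * (X t * Y t) := by ring
      rw [g7] at g1
      have g8 : -2 * (s / ε) * Y t ^ 2 = -2 * (s / ε * Y t ^ 2) := by ring
      linarith
  have hsqκ : Real.exp (-(2 * κ) * t) = Real.exp (-κ * t) ^ 2 := by
    rw [← Real.exp_nat_mul]; congr 1; push_cast; ring
  have hsqω : Real.exp (-(2 * (ω / ε)) * t) = Real.exp (-ω * t / ε) ^ 2 := by
    rw [← Real.exp_nat_mul]; congr 1; push_cast; ring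
  have hNp : N ≤ p * a ^ 2 := by rwa [div_le_iff₀' hp] at ha₁
  have hDN : D / ω * N ≤ p * a ^ 2 := by
    rw [← div_le_iff₀' hp]
    refine le_trans (le_of_eq ?_) ha₂
    rw [hD]; field_simp
  constructor
  · refine le_of_sq_le_sq (le_of_mul_le_mul_left ?_ hp) (by positivity)
    calc p * X t ^ 2 ≤ W₀ * Real.exp (-(2 * κ) * t) := hXW t ht
      _ ≤ N * S ^ 2 * Real.exp (-(2 * κ) * t) := by gcongr
      _ ≤ p * a ^ 2 * S ^ 2 * Real.exp (-(2 * κ) * t) := by gcongr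
      _ = _ := by rw [hsqκ]; ring
  · refine le_of_sq_le_sq (le_of_mul_le_mul_left ?_ hp) (by positivity)
    set u := ε * S * Real.exp (-κ * t) with hu
    set v := Y 0 * Real.exp (-ω * t / ε) with hv
    have hu0 : 0 ≤ u := by positivity
    have hv0 : 0 ≤ v := by positivity
    calc p * Y t ^ 2 ≤ V₂ t := hpV₂ t
      _ ≤ _ := hV₂le
      _ ≤ D / ω * ε ^ 2 * (N * S ^ 2) * Real.exp (-(2 * κ) * t)
          + N * Y 0 ^ 2 * Real.exp (-(2 * (ω / ε)) * t) := by gcongr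
      _ = D / ω * N * u ^ 2 + N * v ^ 2 := by rw [hsqκ, hsqω, hu, hv]; ring
      _ ≤ p * a ^ 2 * u ^ 2 + p * a ^ 2 * v ^ 2 :=
        add_le_add (mul_le_mul_of_nonneg_right hDN (sq_nonneg u))
          (mul_le_mul_of_nonneg_right hNp (sq_nonneg v))
      _ ≤ p * (a * (u + v)) ^ 2 := by
        have : 0 ≤ p * a ^ 2 * (u * v) := by positivity
        linarith

section SlowFast

variable {E₁ E₂ : Type*} [NormedAddCommGroup E₁] [InnerProductSpace ℂ E₁] [FiniteDimensional ℂ E₁]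
  [NormedAddCommGroup E₂] [InnerProductSpace ℂ E₂] [FiniteDimensional ℂ E₂]

theorem hasDerivAt_re_inner_apply_self {E : Type*} [NormedAddCommGroup E] [InnerProductSpace ℂ E]
    (P : E →L[ℂ] E) (hP : ∀ v w, (inner ℂ (P v) w).re = (inner ℂ (P w) v).re)
    {ξ : ℝ → E} {ξ' : E} {t : ℝ} (h : HasDerivAt ξ ξ' t) :
    HasDerivAt (fun t => (inner ℂ (P (ξ t)) (ξ t)).re) (2 * (inner ℂ (P (ξ t)) ξ').re) t := by
  have hPξ : HasDerivAt (fun t => P (ξ t)) (P ξ') t :=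
    (P.restrictScalars ℝ).hasFDerivAt.comp_hasDerivAt t h
  refine (Complex.reCLM.hasFDerivAt.comp_hasDerivAt t (hPξ.inner ℂ h)).congr_deriv ?_
  rw [Complex.reCLM_apply, Complex.add_re, hP ξ']
  ring

theorem re_inner_apply_le {E : Type*} [NormedAddCommGroup E] [InnerProductSpace ℂ E]
    (P : E →L[ℂ] E) {N r : ℝ} (hN : ‖P‖ ≤ N) (v w : E) (hw : ‖w‖ ≤ r) :
    (inner ℂ (P v) w).re ≤ N * ‖v‖ * r :=
  calc (inner ℂ (P v) w).re ≤ ‖P v‖ * ‖w‖ := re_inner_le_norm (𝕜 := ℂ) _ _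
    _ ≤ N * ‖v‖ * r := by
      have := (P.le_opNorm v).trans (mul_le_mul_of_nonneg_right hN (norm_nonneg v))
      have h0 := (norm_nonneg _).trans this
      gcongr

theorem exists_slow_fast_decay_of_almost_decoupled (B : E₁ →L[ℂ] E₁) (A : E₂ →L[ℂ] E₂) {κ ω c : ℝ}
    (hκ : 0 < κ) (hω : 0 < ω) (hc : 0 ≤ c)
    (hB : ∀ μ : ℂ, Module.End.HasEigenvalue (B : E₁ →ₗ[ℂ] E₁) μ → μ.re < -κ)
    (hA : ∀ μ : ℂ, Module.End.HasEigenvalue (A : E₂ →ₗ[ℂ] E₂) μ → μ.re < -ω) :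
    ∃ a d ε₀ : ℝ, 0 < a ∧ 0 < d ∧ 0 < ε₀ ∧ ∀ ε, 0 < ε → ε ≤ ε₀ →
      ∀ (ξ ξ' : ℝ → E₁) (η η' : ℝ → E₂),
        (∀ t, HasDerivAt ξ (ξ' t) t) → (∀ t, HasDerivAt η (η' t) t) →
        (∀ t, ‖ξ' t - B (ξ t)‖ ≤ d * ‖ξ t‖ + c * ε * ‖η t‖) →
        (∀ t, ‖η' t - ((ε⁻¹ : ℝ) : ℂ) • A (η t)‖ ≤ d / ε * ‖η t‖ + c * ‖ξ t‖) →
        ∀ t, 0 ≤ t →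
          ‖ξ t‖ ≤ a * (‖ξ 0‖ + ε * ‖η 0‖) * Real.exp (-κ * t) ∧
          ‖η t‖ ≤ a * (ε * (‖ξ 0‖ + ε * ‖η 0‖) * Real.exp (-κ * t)
            + ‖η 0‖ * Real.exp (-ω * t / ε)) := by
  obtain ⟨P, hPsymm, ⟨p₁, hp₁, hPpos⟩, s₁, hs₁, hPB⟩ := exists_lyapunov B κ hB
  obtain ⟨Q, hQsymm, ⟨p₂, hp₂, hQpos⟩, s₂, hs₂, hQA⟩ := exists_lyapunov A ω hA
  set p := min p₁ p₂
  set s := min s₁ s₂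
  set N := max ‖P‖ ‖Q‖ + 1
  have hp : 0 < p := lt_min hp₁ hp₂
  have hs : 0 < s := lt_min hs₁ hs₂
  have hPN : ‖P‖ ≤ N := (le_max_left ‖P‖ ‖Q‖).trans (le_add_of_nonneg_right zero_le_one)
  have hQN : ‖Q‖ ≤ N := (le_max_right ‖P‖ ‖Q‖).trans (le_add_of_nonneg_right zero_le_one)
  have hN : 0 < N := by positivity
  refine ⟨√(N / p) + √((N * c) ^ 2 * N / (s * p ^ 2 * ω)), s / (2 * N),
    min 1 (min (ω / (2 * κ)) (s ^ 2 / (4 * (N * c) ^ 2 + 1))), by positivity, by positivity,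
    by positivity, fun ε hε hε₀ ξ ξ' η η' hξ hη hξB hηA t ht => ?_⟩
  rw [le_min_iff, le_min_iff, le_div_iff₀ (by positivity), le_div_iff₀ (by positivity)] at hε₀
  refine slow_fast_energy_decay (p := p) (s := s) (N := N) (c := c) (d := s / (2 * N))
    (V₁ := fun t => (inner ℂ (P (ξ t)) (ξ t)).re) (V₂ := fun t => (inner ℂ (Q (η t)) (η t)).re)
    (V₁' := fun t => 2 * (inner ℂ (P (ξ t)) (ξ' t)).re)
    (V₂' := fun t => 2 * (inner ℂ (Q (η t)) (η' t)).re)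
    (X := fun t => ‖ξ t‖) (Y := fun t => ‖η t‖)
    hp hs hN hκ hω hc (le_of_eq (by field_simp)) hε hε₀.1 (by linarith) (by linarith)
    (fun t => norm_nonneg _) (fun t => norm_nonneg _)
    (fun t => hasDerivAt_re_inner_apply_self P hPsymm (hξ t))
    (fun t => hasDerivAt_re_inner_apply_self Q hQsymm (hη t))
    (fun t => le_trans (by gcongr; exact min_le_left _ _) (hPpos (ξ t)))
    (fun t => le_trans (by gcongr; exact min_le_right _ _) (hQpos (η t)))
    ?_ ?_ (fun t => ?_) (fun t => ?_) (by positivity) ?_ ?_ ht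
  · have := re_inner_apply_le P hPN (ξ 0) (ξ 0) le_rfl
    linarith
  · have := re_inner_apply_le Q hQN (η 0) (η 0) le_rfl
    linarith
  · have h1 : (inner ℂ (P (ξ t)) (ξ' t)).re =
        (inner ℂ (P (ξ t)) (B (ξ t))).re + (inner ℂ (P (ξ t)) (ξ' t - B (ξ t))).re := by
      rw [← Complex.add_re, ← inner_add_right, add_sub_cancel]
    have h2 := re_inner_apply_le P hPN (ξ t) _ (hξB t)
    have h3 := hPB (ξ t)
    have h4 : s * ‖ξ t‖ ^ 2 ≤ s₁ * ‖ξ t‖ ^ 2 := by gcongr; exact min_le_left _ _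
    rw [h1]
    linarith
  · have h1 : (inner ℂ (Q (η t)) (η' t)).re = ε⁻¹ * (inner ℂ (Q (η t)) (A (η t))).re
        + (inner ℂ (Q (η t)) (η' t - ((ε⁻¹ : ℝ) : ℂ) • A (η t))).re := by
      rw [← Complex.re_ofReal_mul, ← inner_smul_right, ← Complex.add_re, ← inner_add_right,
        add_sub_cancel]
    have h2 := re_inner_apply_le Q hQN (η t) _ (hηA t)
    have h3 := mul_le_mul_of_nonneg_left (hQA (η t)) (inv_nonneg.2 hε.le)
    have h4 : ε⁻¹ * (s * ‖η t‖ ^ 2) ≤ ε⁻¹ * (s₂ * ‖η t‖ ^ 2) := by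
      gcongr; exact min_le_right _ _
    rw [h1, div_eq_mul_inv ω, div_eq_mul_inv s ε]
    linarith
  · calc N / p = √(N / p) ^ 2 := (Real.sq_sqrt (by positivity)).symm
      _ ≤ _ := by gcongr; exact le_add_of_nonneg_right (by positivity)
  · calc (N * c) ^ 2 * N / (s * p ^ 2 * ω) = √((N * c) ^ 2 * N / (s * p ^ 2 * ω)) ^ 2 :=
          (Real.sq_sqrt (by positivity)).symm
      _ ≤ _ := by gcongr; exact le_add_of_nonneg_left (by positivity)

set_option maxHeartbeats 1000000 in
/-- Decay of slow-fast linear systems `dx/dt = C₁ x + C₂ y`, `ε dy/dt = C₃ x + C₄ y` whose reduced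
operator `C₁ - C₂ C₄⁻¹ C₃` and fast operator `C₄` are stable in the limit `ε → 0`. -/
theorem exists_slow_fast_decay {C₁ Cb : ℝ → E₁ →L[ℂ] E₁} {C₂ H : ℝ → E₂ →L[ℂ] E₁}
    {C₃ L : ℝ → E₁ →L[ℂ] E₂} {C₄ : ℝ → E₂ →L[ℂ] E₂}
    {B : E₁ →L[ℂ] E₁} {A : E₂ →L[ℂ] E₂} {C₂' H' : E₂ →L[ℂ] E₁} {L' : E₁ →L[ℂ] E₂}
    (hCb : Tendsto Cb (𝓝[>] 0) (𝓝 B)) (hC₄ : Tendsto C₄ (𝓝[>] 0) (𝓝 A))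
    (hC₂ : Tendsto C₂ (𝓝[>] 0) (𝓝 C₂')) (hH : Tendsto H (𝓝[>] 0) (𝓝 H'))
    (hL : Tendsto L (𝓝[>] 0) (𝓝 L'))
    (h₁ : ∀ᶠ ε in 𝓝[>] 0, C₁ ε = Cb ε + C₂ ε ∘L L ε)
    (h₃ : ∀ᶠ ε in 𝓝[>] 0, C₃ ε = C₄ ε ∘L L ε)
    (h₂ : ∀ᶠ ε in 𝓝[>] 0, C₂ ε = H ε ∘L C₄ ε)
    {κ ω : ℝ} (hκ : 0 < κ) (hω : 0 < ω)
    (hB : ∀ μ : ℂ, Module.End.HasEigenvalue (B : E₁ →ₗ[ℂ] E₁) μ → μ.re < -κ)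
    (hA : ∀ μ : ℂ, Module.End.HasEigenvalue (A : E₂ →ₗ[ℂ] E₂) μ → μ.re < -ω) :
    ∃ a : ℝ, 0 < a ∧ ∀ᶠ ε in 𝓝[>] (0:ℝ), ∀ (x : ℝ → E₁) (y : ℝ → E₂),
      (∀ t, HasDerivAt x (C₁ ε (x t) + C₂ ε (y t)) t) →
      (∀ t, HasDerivAt y (((ε⁻¹ : ℝ) : ℂ) • (C₃ ε (x t) + C₄ ε (y t))) t) →
      ∀ t, 0 ≤ t →
        ‖x t‖ ≤ a * ((‖x 0‖ + ε * ‖y 0‖) * Real.exp (-κ * t)) ∧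
        ‖y t‖ ≤ a * ((‖x 0‖ + ε * ‖y 0‖) * Real.exp (-κ * t)
          + ‖y 0‖ * Real.exp (-ω * t / ε)) := by
  obtain ⟨K, hK1, hCbK, hC₂K, hHK, hLK⟩ : ∃ K : ℝ, 1 ≤ K ∧ (∀ᶠ ε in 𝓝[>] 0, ‖Cb ε‖ ≤ K) ∧
      (∀ᶠ ε in 𝓝[>] 0, ‖C₂ ε‖ ≤ K) ∧ (∀ᶠ ε in 𝓝[>] 0, ‖H ε‖ ≤ K) ∧
      (∀ᶠ ε in 𝓝[>] 0, ‖L ε‖ ≤ K) := by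
    have e1 := norm_nonneg B
    have e2 := norm_nonneg C₂'
    have e3 := norm_nonneg H'
    have e4 := norm_nonneg L'
    exact ⟨2 + ‖B‖ + ‖C₂'‖ + ‖H'‖ + ‖L'‖, by linarith,
      hCb.norm.eventually_le_const (by linarith), hC₂.norm.eventually_le_const (by linarith),
      hH.norm.eventually_le_const (by linarith), hL.norm.eventually_le_const (by linarith)⟩
  have hK0 : 0 < K := by linarith
  obtain ⟨a, d, ε₀, ha, hd, hε₀, hdecay⟩ := exists_slow_fast_decay_of_almost_decoupled B A hκ hω
    (c := 3 * K ^ 4) (by positivity) hB hA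
  have hCbd : ∀ᶠ ε in 𝓝[>] 0, ‖Cb ε - B‖ ≤ d / 2 :=
    (tendsto_iff_norm_sub_tendsto_zero.1 hCb).eventually_le_const (by positivity)
  have hC₄d : ∀ᶠ ε in 𝓝[>] 0, ‖C₄ ε - A‖ ≤ d / 2 :=
    (tendsto_iff_norm_sub_tendsto_zero.1 hC₄).eventually_le_const (by positivity)
  have hsmall : ∀ {r : ℝ}, 0 < r → ∀ᶠ ε in 𝓝[>] (0:ℝ), ε ≤ r := fun hr =>
    mem_of_superset (Ioc_mem_nhdsGT hr) fun _ h => h.2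
  refine ⟨11 * a * K ^ 4, by positivity, ?_⟩
  filter_upwards [hCbK, hC₂K, hHK, hLK, hCbd, hC₄d, h₁, h₂, h₃, hsmall hε₀, hsmall one_pos,
    hsmall (r := d / (4 * K ^ 3)) (by positivity), hsmall (r := ω / κ) (by positivity),
    self_mem_nhdsWithin] with ε hCbK hC₂K hHK hLK hCbd hC₄d h₁ h₂ h₃ hεε₀ hε1 hεd hεω hε x y hx hy
      t ht
  have hε : 0 < ε := hε
  rw [le_div_iff₀ (by positivity)] at hεd hεω
  have hεC : (ε : ℂ) ≠ 0 := by exact_mod_cast hε.ne'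
  have hnorm : ‖(ε : ℂ)‖ = ε := by rw [Complex.norm_real, Real.norm_of_nonneg hε.le]
  have hnorm' : ‖((ε⁻¹ : ℝ) : ℂ)‖ = ε⁻¹ := by
    rw [Complex.norm_real, Real.norm_of_nonneg (inv_nonneg.2 hε.le)]
  set η : ℝ → E₂ := fun t => y t + L ε (x t) with hη
  set ξ : ℝ → E₁ := fun t => x t - (ε : ℂ) • H ε (η t) with hξ
  set w : ℝ → E₁ := fun t => Cb ε (x t) + C₂ ε (η t) with hw
  have hx' : ∀ t, HasDerivAt x (w t) t := fun t => by
    refine (hx t).congr_deriv ?_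
    simp only [hw, hη, h₁, _root_.add_apply, ContinuousLinearMap.comp_apply, map_add]
    abel
  have hy' : ∀ t, HasDerivAt y (((ε⁻¹ : ℝ) : ℂ) • C₄ ε (η t)) t := fun t => by
    refine (hy t).congr_deriv ?_
    simp only [hη, h₃, ContinuousLinearMap.comp_apply, map_add]
    rw [add_comm]
  have hη' : ∀ t, HasDerivAt η (((ε⁻¹ : ℝ) : ℂ) • C₄ ε (η t) + L ε (w t)) t := fun t =>
    (hy' t).add (((L ε).restrictScalars ℝ).hasFDerivAt.comp_hasDerivAt t (hx' t))
  have hξ' : ∀ t, HasDerivAt ξ (Cb ε (x t) - (ε : ℂ) • H ε (L ε (w t))) t := fun t => by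
    refine ((hx' t).sub ((((H ε).restrictScalars ℝ).hasFDerivAt.comp_hasDerivAt t
      (hη' t)).const_smul (ε : ℂ))).congr_deriv ?_
    simp only [hw, h₂, ContinuousLinearMap.coe_restrictScalars', map_add, map_smul, smul_add,
      smul_smul, ContinuousLinearMap.comp_apply, Complex.ofReal_inv, mul_inv_cancel₀ hεC, one_smul]
    abel
  have hxξ : ∀ t, x t = ξ t + (ε : ℂ) • H ε (η t) := fun t => by simp [hξ]
  have hHη : ∀ t, ‖(ε : ℂ) • H ε (η t)‖ ≤ ε * (K * ‖η t‖) := fun t => by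
    rw [norm_smul, hnorm]
    gcongr
    exact (H ε).le_of_opNorm_le hHK _
  have hxle : ∀ t, ‖x t‖ ≤ ‖ξ t‖ + ε * (K * ‖η t‖) := fun t => by
    rw [hxξ t]
    exact (norm_add_le _ _).trans (by gcongr; exact hHη t)
  have hwle : ∀ t, ‖w t‖ ≤ K * ‖ξ t‖ + 2 * K ^ 2 * ‖η t‖ := fun t => by
    calc ‖w t‖ ≤ ‖Cb ε (x t)‖ + ‖C₂ ε (η t)‖ := norm_add_le _ _
      _ ≤ K * (‖ξ t‖ + ε * (K * ‖η t‖)) + K * ‖η t‖ := by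
        gcongr
        · exact ((Cb ε).le_of_opNorm_le hCbK _).trans (by gcongr; exact hxle t)
        · exact (C₂ ε).le_of_opNorm_le hC₂K _
      _ ≤ K * (‖ξ t‖ + 1 * (K * ‖η t‖)) + K ^ 2 * ‖η t‖ := by
        gcongr
        exact le_self_pow₀ hK1 two_ne_zero
      _ = _ := by ring
  have hLw : ∀ t, ‖L ε (w t)‖ ≤ K * (K * ‖ξ t‖ + 2 * K ^ 2 * ‖η t‖) := fun t =>
    ((L ε).le_of_opNorm_le hLK _).trans (by gcongr; exact hwle t)
  have hK24 : K ^ 2 ≤ K ^ 4 := pow_le_pow_right₀ hK1 (by norm_num)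
  have hdec := hdecay ε hε hεε₀ ξ _ η _ hξ' hη' (fun t => ?_) (fun t => ?_) t ht
  · obtain ⟨hξt, hηt⟩ := hdec
    have hη0 : ‖η 0‖ ≤ ‖y 0‖ + K * ‖x 0‖ :=
      (norm_add_le _ _).trans (by gcongr; exact (L ε).le_of_opNorm_le hLK _)
    have hξ0 : ‖ξ 0‖ ≤ ‖x 0‖ + ε * (K * ‖η 0‖) :=
      (norm_sub_le _ _).trans (by gcongr; exact hHη 0)
    have hyle : ‖y t‖ ≤ ‖η t‖ + K * ‖x t‖ := by
      have : y t = η t - L ε (x t) := by simp [hη]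
      rw [this]
      exact (norm_sub_le _ _).trans (by gcongr; exact (L ε).le_of_opNorm_le hLK _)
    have hf : Real.exp (-ω * t / ε) ≤ Real.exp (-κ * t) := by
      rw [Real.exp_le_exp, div_le_iff₀ hε]
      have := mul_le_mul_of_nonneg_right hεω ht
      linarith
    have hxt := hxle t
    have hf0 := Real.exp_pos (-ω * t / ε)
    have he0 := Real.exp_pos (-κ * t)
    set e := Real.exp (-κ * t)
    set f := Real.exp (-ω * t / ε)
    set σ := ‖x 0‖ + ε * ‖y 0‖ with hσ
    have hx0 := norm_nonneg (x 0)
    have hy0 := norm_nonneg (y 0)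
    have hσ0 : 0 ≤ σ := by positivity
    have hK23 : K ^ 2 ≤ K ^ 3 := pow_le_pow_right₀ hK1 (by norm_num)
    have hK34 : K ^ 3 ≤ K ^ 4 := pow_le_pow_right₀ hK1 (by norm_num)
    have hK12 : K ≤ K ^ 2 := le_self_pow₀ hK1 two_ne_zero
    have hS : ‖ξ 0‖ + ε * ‖η 0‖ ≤ 3 * K ^ 2 * σ := by
      calc ‖ξ 0‖ + ε * ‖η 0‖ ≤ ‖x 0‖ + ε * (K * ‖η 0‖) + ε * ‖η 0‖ := by gcongr
        _ = ‖x 0‖ + ε * ((K + 1) * ‖η 0‖) := by ring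
        _ ≤ ‖x 0‖ + ε * ((K + 1) * (‖y 0‖ + K * ‖x 0‖)) := by gcongr
        _ = (1 + ε * (K ^ 2 + K)) * ‖x 0‖ + (K + 1) * (ε * ‖y 0‖) := by ring
        _ ≤ (1 + 1 * (K ^ 2 + K)) * ‖x 0‖ + (K + 1) * (ε * ‖y 0‖) := by gcongr
        _ ≤ 3 * K ^ 2 * ‖x 0‖ + 3 * K ^ 2 * (ε * ‖y 0‖) := by gcongr <;> linarith
        _ = _ := by rw [hσ]; ring
    have hx0σ : ‖x 0‖ ≤ σ := le_add_of_nonneg_right (by positivity)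
    have hηt' : ‖η t‖ ≤ a * (ε * (3 * K ^ 2 * σ) * e + (‖y 0‖ + K * ‖x 0‖) * f) :=
      hηt.trans (by gcongr)
    have hxfin : ‖x t‖ ≤ 7 * a * K ^ 3 * (σ * e) := by
      calc ‖x t‖ ≤ a * (3 * K ^ 2 * σ) * e
            + ε * (K * (a * (ε * (3 * K ^ 2 * σ) * e + (‖y 0‖ + K * ‖x 0‖) * f))) := by
            refine hxt.trans ?_
            gcongr
            exact hξt.trans (by gcongr)
        _ ≤ a * (3 * K ^ 2 * σ) * e
            + ε * (K * (a * (1 * (3 * K ^ 2 * σ) * e + (‖y 0‖ + K * ‖x 0‖) * e))) := by gcongr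
        _ = a * (3 * K ^ 2 * σ) * e + a * K * (ε * (3 * K ^ 2 * σ) + ε * ‖y 0‖
            + ε * (K * ‖x 0‖)) * e := by ring
        _ ≤ a * (3 * K ^ 2 * σ) * e + a * K * (1 * (3 * K ^ 2 * σ) + K * (ε * ‖y 0‖)
            + 1 * (K * ‖x 0‖)) * e := by
            refine add_le_add le_rfl (mul_le_mul_of_nonneg_right
              (mul_le_mul_of_nonneg_left ?_ (by positivity)) he0.le)
            have := le_mul_of_one_le_left (mul_nonneg hε.le hy0) hK1
            gcongr
        _ = a * (3 * K ^ 2 + 3 * K ^ 3 + K ^ 2) * (σ * e) := by rw [hσ]; ring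
        _ ≤ a * (7 * K ^ 3) * (σ * e) := by gcongr; linarith
        _ = _ := by ring
    constructor
    · refine hxfin.trans ?_
      gcongr
      norm_num
    · calc ‖y t‖ ≤ a * (1 * (3 * K ^ 2 * σ) * e + (‖y 0‖ + K * ‖x 0‖) * f)
            + K * (7 * a * K ^ 3 * (σ * e)) := by
            refine hyle.trans ?_
            gcongr
            exact hηt'.trans (by gcongr)
        _ = a * (3 * K ^ 2 * (σ * e)) + a * K * (‖x 0‖ * f) + a * (1 * (‖y 0‖ * f))
            + 7 * a * K ^ 4 * (σ * e) := by ring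
        _ ≤ a * (3 * K ^ 4 * (σ * e)) + a * K ^ 4 * (σ * e) + a * (11 * K ^ 4 * (‖y 0‖ * f))
            + 7 * a * K ^ 4 * (σ * e) := by
            gcongr
            · linarith
            · linarith
        _ = _ := by ring
  · have hCx : Cb ε (x t) = Cb ε (ξ t) + (ε : ℂ) • Cb ε (H ε (η t)) := by
      rw [hxξ t, map_add, map_smul]
    have heq : Cb ε (x t) - (ε : ℂ) • H ε (L ε (w t)) - B (ξ t) =
        (Cb ε - B) (ξ t) + (ε : ℂ) • (Cb ε (H ε (η t)) - H ε (L ε (w t))) := by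
      rw [hCx, _root_.sub_apply, smul_sub]
      abel
    rw [heq]
    calc _ ≤ d / 2 * ‖ξ t‖ + ε * (K * (K * ‖η t‖)
          + K * (K * (K * ‖ξ t‖ + 2 * K ^ 2 * ‖η t‖))) := by
          refine (norm_add_le _ _).trans ?_
          rw [norm_smul, hnorm]
          gcongr
          · exact (Cb ε - B).le_of_opNorm_le hCbd _
          · refine (norm_sub_le _ _).trans ?_
            gcongr
            · exact ((Cb ε).le_of_opNorm_le hCbK _).trans
                (by gcongr; exact (H ε).le_of_opNorm_le hHK _)
            · exact ((H ε).le_of_opNorm_le hHK _).trans (by gcongr; exact hLw t)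
      _ = (d / 2 + ε * K ^ 3) * ‖ξ t‖ + (K ^ 2 + 2 * K ^ 4) * ε * ‖η t‖ := by ring
      _ ≤ d * ‖ξ t‖ + 3 * K ^ 4 * ε * ‖η t‖ := by
          gcongr
          · have : 0 < ε * K ^ 3 := by positivity
            linarith
          · linarith
  · have heq : ((ε⁻¹ : ℝ) : ℂ) • C₄ ε (η t) + L ε (w t) - ((ε⁻¹ : ℝ) : ℂ) • A (η t) =
        ((ε⁻¹ : ℝ) : ℂ) • (C₄ ε - A) (η t) + L ε (w t) := by
      rw [_root_.sub_apply, smul_sub]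
      abel
    rw [heq]
    calc _ ≤ ε⁻¹ * (d / 2 * ‖η t‖) + K * (K * ‖ξ t‖ + 2 * K ^ 2 * ‖η t‖) := by
          refine (norm_add_le _ _).trans ?_
          rw [norm_smul, hnorm']
          gcongr
          · exact (C₄ ε - A).le_of_opNorm_le hC₄d _
          · exact hLw t
      _ = (d / 2 + 2 * (ε * K ^ 3)) / ε * ‖η t‖ + K ^ 2 * ‖ξ t‖ := by
          field_simp
          ring
      _ ≤ d / ε * ‖η t‖ + 3 * K ^ 4 * ‖ξ t‖ := by
          gcongr
          · linarith
          · have : 0 < K ^ 4 := by positivity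
            linarith

end SlowFast

theorem Matrix.tendsto_mul_of_tendsto {m n k α : Type*} [Fintype n] {l : Filter α}
    {F : α → Matrix m n ℝ} {G : α → Matrix n k ℝ} {M : Matrix m n ℝ} {N : Matrix n k ℝ}
    (hF : Tendsto F l (𝓝 M)) (hG : Tendsto G l (𝓝 N)) :
    Tendsto (fun x => F x * G x) l (𝓝 (M * N)) :=
  ((continuous_fst.matrix_mul continuous_snd).tendsto (M, N)).comp (hF.prodMk_nhds hG)

section Complexify

variable {m n k ι : Type*} [Fintype m] [Fintype n] [Fintype k] [Fintype ι]
  [DecidableEq n]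

/-- The operator between complex Euclidean spaces given by a real matrix. -/
noncomputable def Matrix.complexCLM :
    Matrix m n ℝ →ₗ[ℝ] (EuclideanSpace ℂ n →L[ℂ] EuclideanSpace ℂ m) where
  toFun M := LinearMap.toContinuousLinearMap (Matrix.toLpLin 2 2 (M.map (Complex.ofReal ·)))
  map_add' M N := by
    ext v i
    simp [Matrix.toLpLin_apply, Matrix.mulVec, dotProduct, add_mul, Finset.sum_add_distrib]
  map_smul' r M := by
    ext v i
    simp [Matrix.toLpLin_apply, Matrix.mulVec, dotProduct, mul_assoc, Finset.mul_sum]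

theorem Matrix.complexCLM_apply (M : Matrix m n ℝ) (v : EuclideanSpace ℂ n) (i : m) :
    complexCLM M v i = ∑ j, (M i j : ℂ) * v j := by
  simp [complexCLM, Matrix.toLpLin_apply, Matrix.mulVec, dotProduct]

theorem Matrix.complexCLM_mul [DecidableEq k] (M : Matrix m n ℝ) (N : Matrix n k ℝ) :
    complexCLM (M * N) = complexCLM M ∘L complexCLM N := by
  ext v i
  simp only [ContinuousLinearMap.comp_apply, complexCLM_apply, Matrix.mul_apply,
    Complex.ofReal_sum, Complex.ofReal_mul, Finset.sum_mul, Finset.mul_sum, mul_assoc]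
  exact Finset.sum_comm

theorem Matrix.continuous_complexCLM :
    Continuous (complexCLM : Matrix m n ℝ → EuclideanSpace ℂ n →L[ℂ] EuclideanSpace ℂ m) :=
  LinearMap.continuous_of_finiteDimensional (complexCLM (m := m) (n := n))

theorem Matrix.mem_spectrum_of_hasEigenvalue_complexCLM [DecidableEq m] {M : Matrix m m ℝ} {μ : ℂ}
    (h : Module.End.HasEigenvalue
      (complexCLM M : EuclideanSpace ℂ m →ₗ[ℂ] EuclideanSpace ℂ m) μ) :
    μ ∈ spectrum ℂ (M.map (Complex.ofReal ·)) := by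
  rw [← Matrix.spectrum_toLpLin 2]
  exact h.mem_spectrum

theorem Matrix.isUnit_det_of_spectrum_re_neg [DecidableEq m] {M : Matrix m m ℝ} {ω : ℝ}
    (hω : 0 < ω)
    (h : ∀ ν ∈ spectrum ℂ (M.map (Complex.ofReal ·)), ν.re < -ω) : IsUnit M.det := by
  have h0 : (0 : ℂ) ∉ spectrum ℂ (M.map (Complex.ofReal ·)) := fun h0 => by
    have := h 0 h0
    simp at this
    linarith
  have hu := (Matrix.isUnit_iff_isUnit_det _).1 (spectrum.zero_notMem_iff ℂ |>.1 h0)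
  have hdet : (M.map (Complex.ofReal ·)).det = (M.det : ℂ) :=
    (RingHom.map_det Complex.ofRealHom M).symm
  rw [hdet, isUnit_iff_ne_zero] at hu
  exact isUnit_iff_ne_zero.2 (by exact_mod_cast hu)

theorem Matrix.tendsto_inv_of_isUnit_det [DecidableEq m] {α : Type*} {l : Filter α}
    {F : α → Matrix m m ℝ} {M : Matrix m m ℝ} (hF : Tendsto F l (𝓝 M)) (hM : IsUnit M.det) :
    Tendsto (fun x => (F x)⁻¹) l (𝓝 M⁻¹) := by
  simp only [Matrix.inv_def, Ring.inverse_eq_inv']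
  have hdet : Tendsto (fun x => (F x).det) l (𝓝 M.det) :=
    (continuous_id.matrix_det.tendsto M).comp hF
  have hadj : Tendsto (fun x => (F x).adjugate) l (𝓝 M.adjugate) :=
    (continuous_id.matrix_adjugate.tendsto M).comp hF
  exact (hdet.inv₀ hM.ne_zero).smul hadj

/-- Selected rows of a column of a real matrix, as a vector of a complex Euclidean space. -/
noncomputable def Matrix.complexCol (f : m → ι) (j : ι) :
    Matrix ι ι ℝ →L[ℝ] EuclideanSpace ℂ m :=
  LinearMap.toContinuousLinearMap
    { toFun := fun M => WithLp.toLp 2 fun i => (M (f i) j : ℂ)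
      map_add' := fun M N => by ext i; simp
      map_smul' := fun r M => by ext i; simp }

theorem Matrix.complexCol_apply (f : m → ι) (j : ι) (M : Matrix ι ι ℝ) (i : m) :
    complexCol f j M i = (M (f i) j : ℂ) := rfl

theorem Matrix.norm_le_norm_complexCol (f : m → ι) (j : ι) (M : Matrix ι ι ℝ) (i : m) :
    ‖M (f i) j‖ ≤ ‖complexCol f j M‖ := by
  have := PiLp.norm_apply_le (complexCol f j M) i
  rwa [complexCol_apply, Complex.norm_real] at this

theorem Matrix.norm_complexCol_one [DecidableEq m] [DecidableEq ι] {f : m → ι}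
    (hf : Function.Injective f) (i : m) : ‖complexCol f (f i) (1 : Matrix ι ι ℝ)‖ = 1 := by
  have : complexCol f (f i) (1 : Matrix ι ι ℝ) = EuclideanSpace.single i (1 : ℂ) := by
    ext i'
    rw [complexCol_apply, Matrix.one_apply, PiLp.single_apply]
    simp [hf.eq_iff, apply_ite]
  rw [this]
  simp

theorem Matrix.complexCol_one_eq_zero [DecidableEq ι] {f : m → ι} {j : ι} (hj : ∀ i, f i ≠ j) :
    complexCol f j (1 : Matrix ι ι ℝ) = 0 := by
  ext i
  simp [complexCol_apply, Matrix.one_apply_ne (hj i)]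

end Complexify

/-- Proposition A.1: exponential block estimates for the fundamental
matrix of a singularly perturbed linear system. -/
theorem statement12
    (m₁ m₂ : ℕ) (hm₁ : 0 < m₁) (hm₂ : 0 < m₂)
    (εch : ℝ) (hεch : 0 < εch)
    (C₁ : ℝ → Matrix (Fin m₁) (Fin m₁) ℝ) (C₂ : ℝ → Matrix (Fin m₁) (Fin m₂) ℝ)
    (C₃ : ℝ → Matrix (Fin m₂) (Fin m₁) ℝ) (C₄ : ℝ → Matrix (Fin m₂) (Fin m₂) ℝ)
    (hC₁ : ContinuousOn C₁ (Set.Icc 0 εch)) (hC₂ : ContinuousOn C₂ (Set.Icc 0 εch))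
    (hC₃ : ContinuousOn C₃ (Set.Icc 0 εch)) (hC₄ : ContinuousOn C₄ (Set.Icc 0 εch))
    (C : ℝ → Matrix (Fin m₁ ⊕ Fin m₂) (Fin m₁ ⊕ Fin m₂) ℝ)
    (hC : ∀ ε : ℝ, C ε = Matrix.fromBlocks (C₁ ε) (C₂ ε) ((1 / ε) • C₃ ε) ((1 / ε) • C₄ ε))
    (ω : ℝ) (hω : 0 < ω)
    (hspec4 : ∀ ε ∈ Set.Icc (0:ℝ) εch,
      ∀ ν ∈ spectrum ℂ ((C₄ ε).map (Complex.ofReal ·)), ν.re < -ω)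
    (κ : ℝ) (hκ : 0 < κ)
    (Cb : ℝ → Matrix (Fin m₁) (Fin m₁) ℝ)
    (hCb : ∀ ε : ℝ, Cb ε = C₁ ε - C₂ ε * (C₄ ε)⁻¹ * C₃ ε)
    (hspecb : ∀ ε ∈ Set.Icc (0:ℝ) εch,
      ∀ ν ∈ spectrum ℂ ((Cb ε).map (Complex.ofReal ·)), ν.re < -κ) :
    ∃ εbar, 0 < εbar ∧ εbar ≤ εch ∧ ∃ a > (0:ℝ), ∀ ε ∈ Set.Ioc (0:ℝ) εbar,
      ∀ Ψ : ℝ → Matrix (Fin m₁ ⊕ Fin m₂) (Fin m₁ ⊕ Fin m₂) ℝ, Ψ 0 = 1 →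
        (∀ t : ℝ, HasDerivAt Ψ (C ε * Ψ t) t) →
        ∀ t ∈ Set.Ici (0:ℝ),
          ‖(Ψ t).toBlocks₁₁‖ ≤ a * Real.exp (-κ * t) ∧
          ‖(Ψ t).toBlocks₂₁‖ ≤ a * Real.exp (-κ * t) ∧
          ‖(Ψ t).toBlocks₁₂‖ ≤ a * ε * Real.exp (-κ * t) ∧
          ‖(Ψ t).toBlocks₂₂‖ ≤ a * (ε * Real.exp (-κ * t) + Real.exp (-ω * t / ε)) := by
  have hle : 𝓝[>] (0:ℝ) ≤ 𝓝[Set.Icc 0 εch] 0 :=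
    nhdsWithin_le_of_mem (Icc_mem_nhdsGT hεch)
  have h0 : (0:ℝ) ∈ Set.Icc 0 εch := ⟨le_rfl, hεch.le⟩
  have t₁ := (hC₁ 0 h0).tendsto.mono_left hle
  have t₂ := (hC₂ 0 h0).tendsto.mono_left hle
  have t₃ := (hC₃ 0 h0).tendsto.mono_left hle
  have t₄ := (hC₄ 0 h0).tendsto.mono_left hle
  have hdet : ∀ ε ∈ Set.Icc (0:ℝ) εch, IsUnit (C₄ ε).det := fun ε hε =>
    Matrix.isUnit_det_of_spectrum_re_neg hω (hspec4 ε hε)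
  have tinv := Matrix.tendsto_inv_of_isUnit_det t₄ (hdet 0 h0)
  have tL := Matrix.tendsto_mul_of_tendsto tinv t₃
  have tH := Matrix.tendsto_mul_of_tendsto t₂ tinv
  have tb : Tendsto Cb (𝓝[>] 0) (𝓝 (Cb 0)) := by
    rw [funext hCb]
    exact t₁.sub (Matrix.tendsto_mul_of_tendsto tH t₃)
  have toCLM {m n : ℕ} {F : ℝ → Matrix (Fin m) (Fin n) ℝ} {M : Matrix (Fin m) (Fin n) ℝ}
      (h : Tendsto F (𝓝[>] 0) (𝓝 M)) :
      Tendsto (fun ε => Matrix.complexCLM (F ε)) (𝓝[>] 0) (𝓝 (Matrix.complexCLM M)) :=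
    (Matrix.continuous_complexCLM.tendsto M).comp h
  have hIcc : ∀ᶠ ε in 𝓝[>] (0:ℝ), ε ∈ Set.Icc 0 εch := Icc_mem_nhdsGT hεch
  obtain ⟨a, ha, hdecay⟩ := exists_slow_fast_decay
    (C₁ := fun ε => Matrix.complexCLM (C₁ ε)) (C₃ := fun ε => Matrix.complexCLM (C₃ ε))
    (toCLM tb) (toCLM t₄) (toCLM t₂) (toCLM tH) (toCLM tL)
    (Eventually.of_forall fun ε => by
      rw [← Matrix.complexCLM_mul, ← map_add, hCb, ← Matrix.mul_assoc, sub_add_cancel])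
    (hIcc.mono fun ε hε => by
      rw [← Matrix.complexCLM_mul, Matrix.mul_nonsing_inv_cancel_left _ _ (hdet ε hε)])
    (hIcc.mono fun ε hε => by
      rw [← Matrix.complexCLM_mul, Matrix.nonsing_inv_mul_cancel_right _ _ (hdet ε hε)])
    hκ hω (fun μ hμ => hspecb 0 h0 μ (Matrix.mem_spectrum_of_hasEigenvalue_complexCLM hμ))
    (fun μ hμ => hspec4 0 h0 μ (Matrix.mem_spectrum_of_hasEigenvalue_complexCLM hμ))
  obtain ⟨r, hr, hdecay⟩ := mem_nhdsGT_iff_exists_Ioc_subset.1 hdecay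
  have hr : 0 < r := hr
  refine ⟨min r εch, lt_min hr hεch, min_le_right _ _, a, ha, ?_⟩
  intro ε hε Ψ hΨ0 hΨ t ht
  have hε0 : 0 < ε := hε.1
  have ht : 0 ≤ t := ht
  have key := fun j => hdecay ⟨hε0, hε.2.trans (min_le_left _ _)⟩
    (fun t => Matrix.complexCol Sum.inl j (Ψ t)) (fun t => Matrix.complexCol Sum.inr j (Ψ t))
    (fun t => by
      refine ((Matrix.complexCol Sum.inl j).hasFDerivAt.comp_hasDerivAt t (hΨ t)).congr_deriv ?_
      ext i
      refine (Matrix.complexCol_apply _ _ _ _).trans ?_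
      simp [hC, Matrix.complexCol_apply, Matrix.complexCLM_apply, Matrix.mul_apply])
    (fun t => by
      refine ((Matrix.complexCol Sum.inr j).hasFDerivAt.comp_hasDerivAt t (hΨ t)).congr_deriv ?_
      ext i
      refine (Matrix.complexCol_apply _ _ _ _).trans ?_
      simp [hC, Matrix.complexCol_apply, Matrix.complexCLM_apply, Matrix.mul_apply,
        Finset.mul_sum, mul_assoc])
    t ht
  simp only [hΨ0] at key
  have hf : ∀ j, Matrix.complexCol Sum.inr (Sum.inl j)
      (1 : Matrix (Fin m₁ ⊕ Fin m₂) (Fin m₁ ⊕ Fin m₂) ℝ) = 0 := fun j =>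
    Matrix.complexCol_one_eq_zero (by simp)
  have hs : ∀ j, Matrix.complexCol Sum.inl (Sum.inr j)
      (1 : Matrix (Fin m₁ ⊕ Fin m₂) (Fin m₁ ⊕ Fin m₂) ℝ) = 0 := fun j =>
    Matrix.complexCol_one_eq_zero (by simp)
  have key₁ := fun j => key (Sum.inl j)
  have key₂ := fun j => key (Sum.inr j)
  simp only [hf, hs, Matrix.norm_complexCol_one Sum.inl_injective,
    Matrix.norm_complexCol_one Sum.inr_injective, norm_zero, mul_zero, zero_mul, add_zero,
    zero_add, one_mul, mul_one] at key₁ key₂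
  have he := Real.exp_pos (-κ * t)
  refine ⟨?_, ?_, ?_, ?_⟩ <;> rw [Matrix.norm_le_iff (by positivity)] <;> intro i j
  · exact (Matrix.norm_le_norm_complexCol Sum.inl _ (Ψ t) i).trans ((key₁ j).1)
  · exact (Matrix.norm_le_norm_complexCol Sum.inr _ (Ψ t) i).trans ((key₁ j).2)
  · exact (Matrix.norm_le_norm_complexCol Sum.inl _ (Ψ t) i).trans ((key₂ j).1.trans
      (by rw [mul_assoc]))
  · exact (Matrix.norm_le_norm_complexCol Sum.inr _ (Ψ t) i).trans (key₂ j).2
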